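/- Fix a real a > 0. For each sufficiently small ε > 0, let x(ε) ∈ [0,1] be the unique solution of g(x(ε)) = (1/12)(1 − a^4 ε^4/36). Then as ε → 0⁺, x(ε) = 1 − aε + a^2 ε^2/2 − 5 a^3 ε^3/24 + a^4 ε^4/12 + O(ε^5). -/

import Mathlib

/-- The map `g(x) = x(1+x+x²)/(1+4x+x²)²`. -/
noncomputable def gfun (x : ℝ) : ℝ := x * (1 + x + x ^ 2) / (1 + 4 * x + x ^ 2) ^ 2

lemma aux_quad (t x : ℝ) (ht : 0 < t) (hx0 : 0 ≤ x)
    (h : gfun x = (1/12) * (1 - t ^ 4 / 36)) :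
    6 * (1 - x) ^ 2 = t ^ 2 * (1 + 4 * x + x ^ 2) := by
  have hD : 0 < 1 + 4 * x + x ^ 2 := by positivity
  unfold gfun at h
  rw [div_eq_iff (by positivity)] at h
  have h2 : (6 * (1 - x) ^ 2) ^ 2 = (t ^ 2 * (1 + 4 * x + x ^ 2)) ^ 2 := by
    linear_combination (-432) * h
  exact (sq_eq_sq₀ (by positivity) (by positivity)).1 h2

lemma aux_bound (t u : ℝ) (ht : 0 < t) (ht1 : t < 1) (hu : 0 ≤ u)
    (h : 6 * u ^ 2 = t ^ 2 * (6 - 6 * u + u ^ 2)) :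
    |u - (t - t ^ 2 / 2 + 5 * t ^ 3 / 24 - t ^ 4 / 12)| ≤ 10 * t ^ 5 := by
  set p := t - t ^ 2 / 2 + 5 * t ^ 3 / 24 - t ^ 4 / 12 with hp
  have h2 : t ^ 2 ≤ t := by nlinarith
  have h3 : t ^ 3 ≤ 1 := pow_le_one₀ ht.le ht1.le
  have h4 : t ^ 4 ≤ t ^ 3 := pow_le_pow_of_le_one ht.le ht1.le (by norm_num)
  have h3' : 0 < t ^ 3 := by positivity
  have h4' : 0 < t ^ 4 := by positivity
  have h2' : 0 < t ^ 2 := by positivity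
  have hpt : t / 4 ≤ p := by rw [hp]; linarith
  set S := (6 - t ^ 2) * (u + p) + 6 * t ^ 2 with hS
  have hSt : t ≤ S := by
    have : 5 * (t / 4) ≤ (6 - t ^ 2) * (u + p) :=
      mul_le_mul (by linarith) (by linarith) (by linarith) (by linarith)
    linarith
  set q := 6 * (73/576) - 2/3 - 1/2 + t * (-30/144 + 3/8) + t^2 * (6/144 - 73/576)
    + t^3 * (5/144) - t^4 / 144 with hq
  have hq1 : |q| ≤ 10 := by rw [abs_le, hq]; constructor <;> linarith
  have key : (u - p) * S = - (t ^ 6 * q) := by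
    rw [hS, hq, hp]; linear_combination h
  have habs : |u - p| * S = t ^ 6 * |q| := by
    have := congrArg abs key
    rwa [abs_neg, abs_mul, abs_mul, abs_of_pos (by linarith : 0 < S),
      abs_of_pos (by positivity : 0 < t ^ 6)] at this
  have h5 : |u - p| * t ≤ (10 * t ^ 5) * t := by
    calc |u - p| * t ≤ |u - p| * S := by gcongr
      _ = t ^ 6 * |q| := habs
      _ ≤ t ^ 6 * 10 := by gcongr
      _ = _ := by ring
  exact le_of_mul_le_mul_right h5 ht

/-- For fixed `a > 0` and sufficiently small `ε > 0`, the unique solution `x ∈ [0,1]` of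
`g(x) = (1/12)(1 − a⁴ε⁴/36)` satisfies
`x = 1 − aε + a²ε²/2 − 5a³ε³/24 + a⁴ε⁴/12 + O(ε⁵)`. -/
theorem x_of_eps_expansion (a : ℝ) (ha : 0 < a) :
    ∃ ε₀ > (0:ℝ), ∃ C > (0:ℝ), ∀ ε : ℝ, 0 < ε → ε < ε₀ →
      ∀ x ∈ Set.Icc (0:ℝ) 1, gfun x = (1/12) * (1 - a ^ 4 * ε ^ 4 / 36) →
        |x - (1 - a * ε + a ^ 2 * ε ^ 2 / 2 - 5 * a ^ 3 * ε ^ 3 / 24 + a ^ 4 * ε ^ 4 / 12)|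
          ≤ C * ε ^ 5 := by
  refine ⟨1 / a, by positivity, 10 * a ^ 5, by positivity, ?_⟩
  intro ε hε hε1 x hx h
  have ht : 0 < a * ε := by positivity
  have ht1 : a * ε < 1 := by
    rw [lt_div_iff₀ ha] at hε1
    linarith
  have hquad := aux_quad (a * ε) x ht hx.1 (by rw [h]; ring)
  have hb := aux_bound (a * ε) (1 - x) ht ht1 (by linarith [hx.2])
    (by linear_combination hquad)
  rw [← abs_neg] at hb
  calc _ = _ := by congr 1; ring
    _ ≤ _ := hb
    _ = _ := by ring
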